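/- (Nash equilibrium of the DPI min-max objective.) Define the payoff F(π, η) = E_{s∼d_π}[E_{a∼π(·|s)}[A^η(s,a)]] for policies π, η, and let π* be a policy minimizing J over all policies. Then (π*, π*) is a Nash equilibrium of min_π max_η F(π, η): for every policy η, F(π*, η) ≤ F(π*, π*) = 0, and for every policy π, F(π, π*) ≥ 0 = F(π*, π*). -/

import Mathlib

open scoped BigOperators

noncomputable section

/-- `p` is a probability distribution on a finite type. -/
def IsDist {X : Type*} [Fintype X] (p : X → ℝ) : Prop :=
  (∀ x, 0 ≤ p x) ∧ ∑ x, p x = 1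

/-- `P` is a transition dynamics: `P s a` is a distribution over next states. -/
def IsDynamics {S A : Type*} [Fintype S] (P : S → A → S → ℝ) : Prop :=
  ∀ s a, IsDist (P s a)

/-- `π` is a (stochastic) policy: `π s` is a distribution over actions. -/
def IsPolicy {S A : Type*} [Fintype A] (π : S → A → ℝ) : Prop :=
  ∀ s, IsDist (π s)

/-- One-step evolution of a state distribution under policy `π` and dynamics `P`. -/
def step {S A : Type*} [Fintype S] [Fintype A]
    (P : S → A → S → ℝ) (π : S → A → ℝ) (d : S → ℝ) : S → ℝ :=
  fun s' => ∑ s, ∑ a, d s * π s a * P s a s'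

/-- The time-`t` state distribution `d_π^t` starting from `ρ₀`. -/
def stateDist {S A : Type*} [Fintype S] [Fintype A]
    (P : S → A → S → ℝ) (π : S → A → ℝ) (ρ₀ : S → ℝ) : ℕ → S → ℝ
  | 0 => ρ₀
  | t + 1 => step P π (stateDist P π ρ₀ t)

/-- Discounted state visitation distribution `d_π = (1-γ) Σ_t γ^t d_π^t`. -/
def visit {S A : Type*} [Fintype S] [Fintype A]
    (γ : ℝ) (P : S → A → S → ℝ) (π : S → A → ℝ) (ρ₀ : S → ℝ) : S → ℝ :=
  fun s => (1 - γ) * ∑' t : ℕ, γ ^ t * stateDist P π ρ₀ t s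

/-- Expected cost of one step when the state is distributed as `d` and actions follow `π`. -/
def expCost {S A : Type*} [Fintype S] [Fintype A]
    (c : S → A → ℝ) (π : S → A → ℝ) (d : S → ℝ) : ℝ :=
  ∑ s, ∑ a, d s * π s a * c s a

/-- Value function `V^π(s₀)`: expected total discounted cost starting at `s₀`. -/
def Vf {S A : Type*} [Fintype S] [Fintype A] [DecidableEq S]
    (γ : ℝ) (P : S → A → S → ℝ) (c : S → A → ℝ) (π : S → A → ℝ) (s₀ : S) : ℝ :=
  ∑' t : ℕ, γ ^ t * expCost c π (stateDist P π (fun s => if s = s₀ then 1 else 0) t)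

/-- Objective `J(π) = E_{s∼ρ₀}[V^π(s)]`. -/
def Jf {S A : Type*} [Fintype S] [Fintype A] [DecidableEq S]
    (γ : ℝ) (P : S → A → S → ℝ) (c : S → A → ℝ) (ρ₀ : S → ℝ) (π : S → A → ℝ) : ℝ :=
  ∑ s, ρ₀ s * Vf γ P c π s

/-- State-action value `Q^π(s,a) = c(s,a) + γ E_{s'∼P_{s,a}}[V^π(s')]`. -/
def Qf {S A : Type*} [Fintype S] [Fintype A] [DecidableEq S]
    (γ : ℝ) (P : S → A → S → ℝ) (c : S → A → ℝ) (π : S → A → ℝ) (s : S) (a : A) : ℝ :=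
  c s a + γ * ∑ s', P s a s' * Vf γ P c π s'

/-- Disadvantage function `A^π(s,a) = Q^π(s,a) - V^π(s)`. -/
def Adv {S A : Type*} [Fintype S] [Fintype A] [DecidableEq S]
    (γ : ℝ) (P : S → A → S → ℝ) (c : S → A → ℝ) (π : S → A → ℝ) (s : S) (a : A) : ℝ :=
  Qf γ P c π s a - Vf γ P c π s

section Helpers

variable {S A : Type*} [Fintype S] [Fintype A]

theorem IsDist.le_one {X : Type*} [Fintype X] {p : X → ℝ} (hp : IsDist p) (x : X) : p x ≤ 1 :=
  hp.2 ▸ Finset.single_le_sum (fun y _ => hp.1 y) (Finset.mem_univ x)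

theorem expCost_eq_sum (c : S → A → ℝ) (π : S → A → ℝ) (d : S → ℝ) :
    expCost c π d = ∑ s, d s * ∑ a, π s a * c s a := by
  simp only [expCost, Finset.mul_sum, mul_assoc]

theorem sum_step_mul (P : S → A → S → ℝ) (π : S → A → ℝ) (d v : S → ℝ) :
    ∑ s', step P π d s' * v s' = ∑ s, d s * ∑ a, π s a * ∑ s', P s a s' * v s' := by
  simp only [step, Finset.sum_mul, Finset.mul_sum]
  rw [Finset.sum_comm]
  refine Finset.sum_congr rfl fun s _ => ?_
  rw [Finset.sum_comm]
  simp only [mul_assoc]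

theorem IsDist.step {P : S → A → S → ℝ} {π : S → A → ℝ} {d : S → ℝ}
    (hP : IsDynamics P) (hπ : IsPolicy π) (hd : IsDist d) : IsDist (step P π d) := by
  refine ⟨fun s' => Finset.sum_nonneg fun s _ => Finset.sum_nonneg fun a _ =>
    mul_nonneg (mul_nonneg (hd.1 s) ((hπ s).1 a)) ((hP s a).1 s'), ?_⟩
  simpa [(hP _ _).2, (hπ _).2, hd.2] using sum_step_mul P π d fun _ => 1

theorem IsDist.stateDist {P : S → A → S → ℝ} {π : S → A → ℝ} {ρ : S → ℝ}
    (hP : IsDynamics P) (hπ : IsPolicy π) (hρ : IsDist ρ) (t : ℕ) :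
    IsDist (stateDist P π ρ t) := by
  induction t with
  | zero => exact hρ
  | succ t ih => exact ih.step hP hπ

theorem isDist_indicator [DecidableEq S] (s₀ : S) :
    IsDist (fun s => if s = s₀ then (1 : ℝ) else 0) :=
  ⟨fun s => by dsimp only; split_ifs <;> norm_num, by simp⟩

/-- State distributions depend linearly on the initial distribution. -/
theorem stateDist_eq_sum [DecidableEq S] (P : S → A → S → ℝ) (π : S → A → ℝ) (ρ : S → ℝ)
    (t : ℕ) (s : S) :
    stateDist P π ρ t s =
      ∑ s₀, ρ s₀ * stateDist P π (fun s => if s = s₀ then 1 else 0) t s := by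
  induction t generalizing s with
  | zero => simp [stateDist]
  | succ t ih =>
    simp only [stateDist, step, ih, Finset.sum_mul, Finset.mul_sum]
    rw [Finset.sum_congr rfl fun _ _ => Finset.sum_comm, Finset.sum_comm]
    simp only [mul_assoc]

theorem summable_discounted_stateDist {γ : ℝ} {P : S → A → S → ℝ} {π : S → A → ℝ} {ρ : S → ℝ}
    (hγ : 0 ≤ γ) (hγ' : γ < 1) (hP : IsDynamics P) (hπ : IsPolicy π) (hρ : IsDist ρ) (s : S) :
    Summable fun t => γ ^ t * stateDist P π ρ t s :=
  (summable_geometric_of_lt_one hγ hγ').of_nonneg_of_le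
    (fun t => mul_nonneg (pow_nonneg hγ t) ((hρ.stateDist hP hπ t).1 s))
    (fun t => mul_le_of_le_one_right (pow_nonneg hγ t) ((hρ.stateDist hP hπ t).le_one s))

/-- The discounted sum of the expectations of `f` is its pairing with the discounted occupancy. -/
theorem hasSum_discounted_expectation {γ : ℝ} {P : S → A → S → ℝ} {π : S → A → ℝ} {ρ : S → ℝ}
    (hγ : 0 ≤ γ) (hγ' : γ < 1) (hP : IsDynamics P) (hπ : IsPolicy π) (hρ : IsDist ρ)
    (f : S → ℝ) :
    HasSum (fun t => γ ^ t * ∑ s, stateDist P π ρ t s * f s)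
      (∑ s, (∑' t, γ ^ t * stateDist P π ρ t s) * f s) := by
  simp only [Finset.mul_sum, ← mul_assoc]
  exact hasSum_sum fun s _ =>
    (summable_discounted_stateDist hγ hγ' hP hπ hρ s).hasSum.mul_right (f s)

/-- `J(π)` is the expected discounted cost along the state distributions started at `ρ`. -/
theorem Jf_eq_tsum [DecidableEq S] {γ : ℝ} {P : S → A → S → ℝ} {π : S → A → ℝ}
    (hγ : 0 ≤ γ) (hγ' : γ < 1) (hP : IsDynamics P) (hπ : IsPolicy π)
    (c : S → A → ℝ) (ρ : S → ℝ) :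
    Jf γ P c ρ π = ∑' t, γ ^ t * expCost c π (stateDist P π ρ t) := by
  have h : ∀ s₀, HasSum (fun t => ρ s₀ *
      (γ ^ t * expCost c π (stateDist P π (fun s => if s = s₀ then 1 else 0) t)))
      (ρ s₀ * Vf γ P c π s₀) := fun s₀ => by
    simp only [Vf, expCost_eq_sum]
    exact (hasSum_discounted_expectation hγ hγ' hP hπ (isDist_indicator s₀) _).summable.hasSum
      |>.mul_left _
  rw [Jf, ← (hasSum_sum fun s₀ _ => h s₀).tsum_eq]
  refine tsum_congr fun t => ?_
  simp only [expCost_eq_sum]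
  simp_rw [stateDist_eq_sum P π ρ t, Finset.sum_mul]
  rw [Finset.sum_comm, Finset.mul_sum]
  refine Finset.sum_congr rfl fun s₀ _ => ?_
  simp only [mul_assoc, ← Finset.mul_sum]
  ring

/-- Performance difference lemma. -/
theorem sum_visit_mul_adv [DecidableEq S] {γ : ℝ} {P : S → A → S → ℝ} {π : S → A → ℝ}
    {ρ : S → ℝ} (hγ : 0 ≤ γ) (hγ' : γ < 1) (hP : IsDynamics P) (hπ : IsPolicy π)
    (hρ : IsDist ρ) (c : S → A → ℝ) (η : S → A → ℝ) :
    ∑ s, visit γ P π ρ s * ∑ a, π s a * Adv γ P c η s a =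
      (1 - γ) * (Jf γ P c ρ π - Jf γ P c ρ η) := by
  have hE := fun f => hasSum_discounted_expectation hγ hγ' hP hπ hρ f
  have hv := (hE (Vf γ P c η)).summable
  have hcost : Summable fun t => γ ^ t * expCost c π (stateDist P π ρ t) := by
    simpa only [expCost_eq_sum] using (hE _).summable
  have hstep : ∀ t, γ ^ t * ∑ s, stateDist P π ρ t s * ∑ a, π s a * Adv γ P c η s a =
      γ ^ t * expCost c π (stateDist P π ρ t) +
        (γ ^ (t + 1) * ∑ s, stateDist P π ρ (t + 1) s * Vf γ P c η s -
          γ ^ t * ∑ s, stateDist P π ρ t s * Vf γ P c η s) := fun t => by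
    have hadv : ∀ s, ∑ a, π s a * Adv γ P c η s a =
        ∑ a, π s a * c s a + γ * ∑ a, π s a * ∑ s', P s a s' * Vf γ P c η s' -
          Vf γ P c η s := fun s => by
      simp only [Adv, Qf, mul_sub, mul_add, Finset.sum_sub_distrib, Finset.sum_add_distrib,
        ← Finset.sum_mul, (hπ s).2, one_mul, mul_left_comm _ γ, ← Finset.mul_sum]
    simp only [hadv, mul_sub, mul_add, Finset.sum_sub_distrib, Finset.sum_add_distrib,
      mul_left_comm _ γ, ← Finset.mul_sum, stateDist, sum_step_mul, expCost_eq_sum]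
    ring
  have hv' := (summable_nat_add_iff 1).2 hv
  have htsum := (hE fun s => ∑ a, π s a * Adv γ P c η s a).tsum_eq
  rw [tsum_congr hstep, hcost.tsum_add (hv'.sub hv), hv'.tsum_sub hv,
    hv.tsum_eq_zero_add, ← Jf_eq_tsum hγ hγ' hP hπ] at htsum
  simp only [visit, mul_assoc (1 - γ), ← Finset.mul_sum]
  rw [← htsum]
  simp only [stateDist, Jf, pow_zero, one_mul]
  ring

end Helpers

/-- **Nash equilibrium of the DPI min-max objective.** With
`F(π, η) = E_{s∼d_π}[E_{a∼π(·|s)}[A^η(s,a)]]` and `π*` a minimizer of `J` over all policies,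
`(π*, π*)` is a Nash equilibrium: `F(π*, η) ≤ F(π*, π*) = 0 ≤ F(π, π*)` for all policies. -/
theorem dpi_nash_equilibrium
    {S A : Type*} [Fintype S] [Fintype A] [DecidableEq S]
    (γ : ℝ) (P : S → A → S → ℝ) (c : S → A → ℝ) (ρ₀ : S → ℝ)
    (hγ : 0 < γ) (hγ' : γ < 1) (hP : IsDynamics P) (hρ : IsDist ρ₀)
    (hc : ∀ s a, 0 ≤ c s a ∧ c s a ≤ 1)
    (πopt : S → A → ℝ) (hπopt : IsPolicy πopt)
    (hopt : ∀ π : S → A → ℝ, IsPolicy π → Jf γ P c ρ₀ πopt ≤ Jf γ P c ρ₀ π) :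
    (∀ η : S → A → ℝ, IsPolicy η →
        (∑ s, visit γ P πopt ρ₀ s * ∑ a, πopt s a * Adv γ P c η s a) ≤
          ∑ s, visit γ P πopt ρ₀ s * ∑ a, πopt s a * Adv γ P c πopt s a) ∧
      (∑ s, visit γ P πopt ρ₀ s * ∑ a, πopt s a * Adv γ P c πopt s a) = 0 ∧
      (∀ π : S → A → ℝ, IsPolicy π →
        0 ≤ ∑ s, visit γ P π ρ₀ s * ∑ a, π s a * Adv γ P c πopt s a) := by
  have hF := fun (π η : S → A → ℝ) (hπ : IsPolicy π) =>
    sum_visit_mul_adv hγ.le hγ' hP hπ hρ c η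
  have hγ₁ : 0 ≤ 1 - γ := sub_nonneg.2 hγ'.le
  refine ⟨fun η hη => ?_, ?_, fun π hπ => ?_⟩
  · rw [hF _ _ hπopt, hF _ _ hπopt]
    exact mul_le_mul_of_nonneg_left (sub_le_sub_left (hopt η hη) _) hγ₁
  · rw [hF _ _ hπopt, sub_self, mul_zero]
  · rw [hF _ _ hπ]
    exact mul_nonneg hγ₁ (sub_nonneg.2 (hopt π hπ))
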